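/- Let α be irrational and not equivalent to the golden ratio (1+√5)/2. Then 𝔨(α) = liminf over n → ∞ with aₙ ≥ 2 of min(κ¹ₙ(α), κ²ₙ(α), κ⁴ₙ(α)). -/

import Mathlib

open Filter

/-- The tails `αₙ = [aₙ; aₙ₊₁, …]` of the continued fraction of `α`. -/
noncomputable def cfTail (α : ℝ) : ℕ → ℝ
  | 0 => α
  | n + 1 => (Int.fract (cfTail α n))⁻¹

/-- The partial quotients `aₙ` of the continued fraction of `α`. -/
noncomputable def cfDigit (α : ℝ) (n : ℕ) : ℤ := ⌊cfTail α n⌋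

/-- Value `[a; b, c, …]` of a finite continued fraction given by a list. -/
noncomputable def finCF : List ℤ → ℝ
  | [] => 0
  | a :: l => (a : ℝ) + (finCF l)⁻¹

/-- `α*ₙ = [0; aₙ, aₙ₋₁, …, a₁]`. -/
noncomputable def cfStar (α : ℝ) (n : ℕ) : ℝ :=
  (finCF (((List.range' 1 n).reverse).map (cfDigit α)))⁻¹

/-- Numerators `pₙ` of the convergents of `α`. -/
noncomputable def cfNum (α : ℝ) : ℕ → ℤ
  | 0 => cfDigit α 0
  | 1 => cfDigit α 1 * cfDigit α 0 + 1
  | n + 2 => cfDigit α (n + 2) * cfNum α (n + 1) + cfNum α n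

/-- Denominators `qₙ` of the convergents of `α`. -/
noncomputable def cfDen (α : ℝ) : ℕ → ℤ
  | 0 => 1
  | 1 => cfDigit α 1
  | n + 2 => cfDigit α (n + 2) * cfDen α (n + 1) + cfDen α n

/-- The irrationality measure function `ψ_α^[2]` for "second best" approximations. -/
noncomputable def psi2 (α : ℝ) (t : ℝ) : ℝ :=
  sInf { x : ℝ | ∃ p q : ℤ, 1 ≤ q ∧ (q : ℝ) ≤ t ∧
    (∀ n : ℕ, (p, q) ≠ (cfNum α n, cfDen α n)) ∧ x = |(q : ℝ) * α - (p : ℝ)| }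

/-- The Diophantine constant `𝔨(α) = liminf_{t → ∞} t · ψ_α^[2](t)`. -/
noncomputable def kConst (α : ℝ) : ℝ := liminf (fun t : ℝ => t * psi2 α t) atTop

/-- Two numbers are equivalent if the tails of their continued fraction expansions
coincide: `a_{n+k} = b_{m+k}` for all `k ≥ 1`, for some positive integers `m`, `n`. -/
def CFEquiv (α β : ℝ) : Prop :=
  ∃ n m : ℕ, 0 < n ∧ 0 < m ∧ ∀ k : ℕ, 0 < k → cfDigit α (n + k) = cfDigit β (m + k)

/-- The spectrum `𝕃₂` of values of `𝔨`. -/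
def L2 : Set ℝ := { l : ℝ | ∃ α : ℝ, Irrational α ∧ l = kConst α }

/-- `κ¹ₙ(α) = (1 + α*ₙ₋₁)(αₙ − 1)/(αₙ + α*ₙ₋₁)`. -/
noncomputable def kappa1 (α : ℝ) (n : ℕ) : ℝ :=
  (1 + cfStar α (n - 1)) * (cfTail α n - 1) / (cfTail α n + cfStar α (n - 1))

/-- `κ²ₙ(α) = (1 − α*ₙ)(αₙ₊₁ + 1)/(αₙ₊₁ + α*ₙ)`. -/
noncomputable def kappa2 (α : ℝ) (n : ℕ) : ℝ :=
  (1 - cfStar α n) * (cfTail α (n + 1) + 1) / (cfTail α (n + 1) + cfStar α n)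

/-- `κ⁴ₙ(α) = 4/(αₙ + α*ₙ₋₁)`. -/
noncomputable def kappa4 (α : ℝ) (n : ℕ) : ℝ :=
  4 / (cfTail α n + cfStar α (n - 1))

section Tails

variable {α : ℝ}

lemma cfTail_irrational (hα : Irrational α) (n : ℕ) : Irrational (cfTail α n) := by
  induction n with
  | zero => exact hα
  | succ n ih =>
    simp only [cfTail, irrational_inv_iff, Int.fract]
    exact ih.sub_intCast _

lemma fract_cfTail_pos (hα : Irrational α) (n : ℕ) : 0 < Int.fract (cfTail α n) :=
  Int.fract_pos.2 fun h => (cfTail_irrational hα n).ne_int _ h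

lemma one_lt_cfTail_succ (hα : Irrational α) (n : ℕ) : 1 < cfTail α (n + 1) :=
  one_lt_inv_iff₀.2 ⟨fract_cfTail_pos hα n, Int.fract_lt_one _⟩

lemma cfTail_eq_cfDigit_add_inv (n : ℕ) :
    cfTail α n = cfDigit α n + (cfTail α (n + 1))⁻¹ := by
  simp only [cfTail, inv_inv, cfDigit]
  exact (Int.floor_add_fract _).symm

lemma one_le_cfDigit_succ (hα : Irrational α) (n : ℕ) : 1 ≤ cfDigit α (n + 1) :=
  Int.le_floor.2 (by simpa using (one_lt_cfTail_succ hα n).le)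

lemma cfDigit_le_cfTail (n : ℕ) : (cfDigit α n : ℝ) ≤ cfTail α n := Int.floor_le _

lemma cfTail_lt_cfDigit_add_one (n : ℕ) : cfTail α n < cfDigit α n + 1 :=
  Int.lt_floor_add_one _

lemma cfTail_goldenRatio (n : ℕ) :
    cfTail ((1 + Real.sqrt 5) / 2) n = (1 + Real.sqrt 5) / 2 := by
  induction n with
  | zero => rfl
  | succ n ih =>
    have h5 : Real.sqrt 5 * Real.sqrt 5 = 5 := Real.mul_self_sqrt (by norm_num)
    have h0 := Real.sqrt_nonneg 5
    have hfloor : ⌊(1 + Real.sqrt 5) / 2⌋ = 1 := by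
      rw [Int.floor_eq_iff]
      constructor <;> push_cast <;> nlinarith
    rw [cfTail, ih, Int.fract, hfloor]
    apply inv_eq_of_mul_eq_one_left
    push_cast
    nlinarith

lemma cfDigit_goldenRatio (n : ℕ) : cfDigit ((1 + Real.sqrt 5) / 2) n = 1 := by
  have h5 : Real.sqrt 5 * Real.sqrt 5 = 5 := Real.mul_self_sqrt (by norm_num)
  have h0 := Real.sqrt_nonneg 5
  rw [cfDigit, cfTail_goldenRatio, Int.floor_eq_iff]
  constructor <;> push_cast <;> nlinarith

lemma frequently_two_le_cfDigit (hα : Irrational α)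
    (h : ¬ CFEquiv α ((1 + Real.sqrt 5) / 2)) : ∃ᶠ n in atTop, 2 ≤ cfDigit α n := by
  intro hev
  obtain ⟨N, hN⟩ := eventually_atTop.1 hev
  refine h ⟨N + 1, 1, by omega, by omega, fun k _ => ?_⟩
  rw [cfDigit_goldenRatio]
  have h1 := hN (N + 1 + k) (by omega)
  have h2 := one_le_cfDigit_succ hα (N + k)
  rw [show N + k + 1 = N + 1 + k by omega] at h2
  omega

end Tails

section Convergents

variable {α : ℝ}

lemma cfDen_pos (hα : Irrational α) (n : ℕ) : 0 < cfDen α n := by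
  induction n using Nat.twoStepInduction with
  | zero => simp [cfDen]
  | one => exact one_le_cfDigit_succ hα 0
  | more n ih₀ ih₁ =>
    have : 0 < cfDigit α (n + 2) * cfDen α (n + 1) := mul_pos (one_le_cfDigit_succ hα (n + 1)) ih₁
    simp only [cfDen]
    omega

lemma cfDen_le_succ (hα : Irrational α) (n : ℕ) : cfDen α n ≤ cfDen α (n + 1) := by
  cases n with
  | zero => exact one_le_cfDigit_succ hα 0
  | succ n =>
    have h₀ := cfDen_pos hα n
    have h₁ := cfDen_pos hα (n + 1)
    have h₂ := one_le_cfDigit_succ hα (n + 1)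
    simp only [cfDen]
    nlinarith

lemma cfDen_mono (hα : Irrational α) : Monotone (cfDen α) :=
  monotone_nat_of_le_succ (cfDen_le_succ hα)

lemma le_cfDen (hα : Irrational α) (n : ℕ) : (n : ℤ) ≤ cfDen α n := by
  induction n using Nat.twoStepInduction with
  | zero => simp [cfDen]
  | one => exact one_le_cfDigit_succ hα 0
  | more n _ ih₁ =>
    have h₀ := cfDen_pos hα n
    have h₁ := cfDen_pos hα (n + 1)
    have h₂ := one_le_cfDigit_succ hα (n + 1)
    simp only [cfDen]
    push_cast at ih₁ ⊢
    nlinarith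

lemma ne_convergent_of_between (hα : Irrational α) {p q : ℤ} {n : ℕ}
    (h₁ : cfDen α n < q) (h₂ : q < cfDen α (n + 1)) (m : ℕ) :
    (p, q) ≠ (cfNum α m, cfDen α m) := by
  intro h
  have hq : q = cfDen α m := congrArg Prod.snd h
  rcases le_or_gt m n with hm | hm
  · have := cfDen_mono hα hm
    omega
  · have := cfDen_mono hα (Nat.succ_le_of_lt hm)
    simp only [Nat.succ_eq_add_one] at this
    omega

lemma cfNum_mul_cfDen_sub (n : ℕ) :
    cfNum α (n + 1) * cfDen α n - cfNum α n * cfDen α (n + 1) = (-1) ^ n := by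
  induction n with
  | zero => simp [cfNum, cfDen]; ring
  | succ n ih =>
    simp only [cfNum, cfDen] at ih ⊢
    rw [pow_succ, ← ih]
    ring

lemma cfStar_succ (n : ℕ) : cfStar α (n + 1) = (cfDigit α (n + 1) + cfStar α n)⁻¹ := by
  simp only [cfStar, List.range'_concat, List.reverse_append, List.reverse_cons, List.reverse_nil,
    List.nil_append, List.cons_append, List.map_cons, finCF, one_mul]
  rw [add_comm 1 n]

lemma cfStar_succ_eq_div (hα : Irrational α) (n : ℕ) :
    cfStar α (n + 1) = cfDen α n / cfDen α (n + 1) := by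
  induction n with
  | zero => simp [cfStar, finCF, cfDen]
  | succ n ih =>
    have h : (0 : ℝ) < cfDen α (n + 1) := by exact_mod_cast cfDen_pos hα (n + 1)
    rw [cfStar_succ, ih]
    simp only [cfDen]
    push_cast
    rw [← inv_div]
    field_simp

lemma cfStar_succ_pos (hα : Irrational α) (n : ℕ) : 0 < cfStar α (n + 1) := by
  rw [cfStar_succ_eq_div hα]
  have h₀ : (0 : ℝ) < cfDen α n := by exact_mod_cast cfDen_pos hα n
  have h₁ : (0 : ℝ) < cfDen α (n + 1) := by exact_mod_cast cfDen_pos hα (n + 1)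
  positivity

lemma cfStar_succ_le_one (hα : Irrational α) (n : ℕ) : cfStar α (n + 1) ≤ 1 := by
  rw [cfStar_succ_eq_div hα]
  have h₁ : (0 : ℝ) < cfDen α (n + 1) := by exact_mod_cast cfDen_pos hα (n + 1)
  rw [div_le_one h₁]
  exact_mod_cast cfDen_le_succ hα n

lemma cfDen_mul_sub_cfNum (hα : Irrational α) (n : ℕ) :
    cfDen α n * α - cfNum α n
      = -cfTail α (n + 2) * (cfDen α (n + 1) * α - cfNum α (n + 1)) := by
  induction n with
  | zero =>
    have h0 := cfTail_eq_cfDigit_add_inv (α := α) 0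
    have h1 := cfTail_eq_cfDigit_add_inv (α := α) 1
    have e1 : cfTail α 1 ≠ 0 := (zero_lt_one.trans (one_lt_cfTail_succ hα 0)).ne'
    have e2 : cfTail α 2 ≠ 0 := (zero_lt_one.trans (one_lt_cfTail_succ hα 1)).ne'
    simp only [cfDen, cfNum, zero_add] at *
    norm_num at h1
    rw [show cfTail α 0 = α from rfl] at h0
    push_cast
    have k0 : α - cfDigit α 0 = (cfTail α 1)⁻¹ := by linarith
    have k1 : (cfDigit α 1 : ℝ) = cfTail α 1 - (cfTail α 2)⁻¹ := by linarith
    have : (cfDigit α 1 : ℝ) * α - (cfDigit α 1 * cfDigit α 0 + 1)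
        = cfDigit α 1 * (α - cfDigit α 0) - 1 := by ring
    rw [this, one_mul, k0, k1]
    field_simp
    ring
  | succ n ih =>
    have h1 := cfTail_eq_cfDigit_add_inv (α := α) (n + 2)
    have e : cfTail α (n + 3) ≠ 0 := (zero_lt_one.trans (one_lt_cfTail_succ hα (n + 2))).ne'
    have k1 : (cfDigit α (n + 2) : ℝ) = cfTail α (n + 2) - (cfTail α (n + 3))⁻¹ := by linarith
    have : (cfDen α (n + 2) : ℝ) * α - cfNum α (n + 2)
        = cfDigit α (n + 2) * (cfDen α (n + 1) * α - cfNum α (n + 1))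
          + (cfDen α n * α - cfNum α n) := by
      simp only [cfDen, cfNum]
      push_cast
      ring
    rw [show n + 1 + 2 = n + 3 from rfl, show n + 1 + 1 = n + 2 from rfl, this, ih, k1]
    field_simp
    ring

lemma abs_cfDen_mul_sub_cfNum (hα : Irrational α) (n : ℕ) :
    |(cfDen α (n + 1) : ℝ) * α - cfNum α (n + 1)|
      = (cfDen α (n + 1) * (cfTail α (n + 2) + cfStar α (n + 1)))⁻¹ := by
  have h₀ : (0 : ℝ) < cfDen α n := by exact_mod_cast cfDen_pos hα n
  have h₁ : (0 : ℝ) < cfDen α (n + 1) := by exact_mod_cast cfDen_pos hα (n + 1)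
  have ht := one_lt_cfTail_succ hα (n + 1)
  have hdet : ((cfNum α (n + 1) : ℝ) * cfDen α n - cfNum α n * cfDen α (n + 1)) = (-1) ^ n := by
    exact_mod_cast cfNum_mul_cfDen_sub (α := α) n
  have hrec := cfDen_mul_sub_cfNum hα n
  have hpos : 0 < cfTail α (n + 2) * cfDen α (n + 1) + cfDen α n :=
    add_pos (mul_pos (zero_lt_one.trans ht) h₁) h₀
  have key : (cfDen α (n + 1) * α - cfNum α (n + 1))
      * (cfTail α (n + 2) * cfDen α (n + 1) + cfDen α n) = -(-1) ^ n := by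
    rw [← hdet]
    linear_combination (cfDen α (n + 1) : ℝ) * hrec
  have habs := congrArg abs key
  rw [abs_mul, abs_of_pos hpos, abs_neg, abs_pow, abs_neg, abs_one, one_pow] at habs
  rw [eq_inv_of_mul_eq_one_left habs, cfStar_succ_eq_div hα]
  congr 1
  field_simp

lemma mul_abs_combination (hα : Irrational α) (n : ℕ) (u v : ℤ) :
    ((u * cfDen α (n + 1) + v * cfDen α n : ℤ) : ℝ)
        * |((u * cfDen α (n + 1) + v * cfDen α n : ℤ) : ℝ) * α
            - ((u * cfNum α (n + 1) + v * cfNum α n : ℤ) : ℝ)|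
      = (u + v * cfStar α (n + 1)) * |u - v * cfTail α (n + 2)|
        / (cfTail α (n + 2) + cfStar α (n + 1)) := by
  have h₁ : (0 : ℝ) < cfDen α (n + 1) := by exact_mod_cast cfDen_pos hα (n + 1)
  have hx := cfStar_succ_pos hα n
  have ht := one_lt_cfTail_succ hα (n + 1)
  have hrec := cfDen_mul_sub_cfNum hα n
  have e : ((u * cfDen α (n + 1) + v * cfDen α n : ℤ) : ℝ) * α
            - ((u * cfNum α (n + 1) + v * cfNum α n : ℤ) : ℝ)
      = (cfDen α (n + 1) * α - cfNum α (n + 1)) * (u - v * cfTail α (n + 2)) := by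
    push_cast
    linear_combination (v : ℝ) * hrec
  have hs : cfTail α (n + 2) + cfStar α (n + 1) ≠ 0 := by
    have : (0 : ℝ) < cfTail α (n + 2) := zero_lt_one.trans ht
    positivity
  have e₂ : ((u * cfDen α (n + 1) + v * cfDen α n : ℤ) : ℝ)
      = cfDen α (n + 1) * (u + v * cfStar α (n + 1)) := by
    rw [cfStar_succ_eq_div hα]
    push_cast
    field_simp
  rw [e, abs_mul, abs_cfDen_mul_sub_cfNum hα, e₂]
  field_simp

lemma exists_eq_combination (α : ℝ) (n : ℕ) (p q : ℤ) : ∃ u v : ℤ,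
    p = u * cfNum α (n + 1) + v * cfNum α n ∧ q = u * cfDen α (n + 1) + v * cfDen α n := by
  have hdet := cfNum_mul_cfDen_sub (α := α) n
  have hsq : ((-1 : ℤ) ^ n) * (-1) ^ n = 1 := by rw [← mul_pow]; simp
  refine ⟨(-1) ^ n * (p * cfDen α n - q * cfNum α n),
    (-1) ^ n * (q * cfNum α (n + 1) - p * cfDen α (n + 1)), ?_, ?_⟩
  · linear_combination (-(-1) ^ n * p) * hdet - p * hsq
  · linear_combination (-(-1) ^ n * q) * hdet - q * hsq

end Convergents

section Kappa

variable {α : ℝ}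

lemma kappa2_eq (hα : Irrational α) (n : ℕ) :
    kappa2 α (n + 2) = (cfDigit α (n + 2) + cfStar α (n + 1) - 1)
      * (cfTail α (n + 2) - cfDigit α (n + 2) + 1)
        / (cfTail α (n + 2) + cfStar α (n + 1)) := by
  have hx := cfStar_succ_pos hα n
  have ha : (1 : ℝ) ≤ cfDigit α (n + 2) := by exact_mod_cast one_le_cfDigit_succ hα (n + 1)
  have ht : 0 < cfTail α (n + 3) := zero_lt_one.trans (one_lt_cfTail_succ hα (n + 2))
  have htail := cfTail_eq_cfDigit_add_inv (α := α) (n + 2)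
  have hs : 0 < cfDigit α (n + 2) + cfStar α (n + 1) := by linarith
  rw [kappa2, cfStar_succ, htail, show n + 2 + 1 = n + 3 from rfl, show n + 1 + 1 = n + 2 from rfl]
  have h₁ : cfTail α (n + 3) + (cfDigit α (n + 2) + cfStar α (n + 1))⁻¹ ≠ 0 := by positivity
  have h₂ : cfDigit α (n + 2) + (cfTail α (n + 3))⁻¹ + cfStar α (n + 1) ≠ 0 := by positivity
  rw [div_eq_div_iff h₁ h₂]
  field_simp
  ring

lemma min_kappa_le_one (hα : Irrational α) (n : ℕ) (ha : 2 ≤ cfDigit α (n + 2)) :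
    min (kappa1 α (n + 2)) (min (kappa2 α (n + 2)) (kappa4 α (n + 2))) ≤ 1 := by
  rw [kappa2_eq hα, kappa1, kappa4, show n + 2 - 1 = n + 1 from rfl]
  have hx := cfStar_succ_pos hα n
  have hx₁ := cfStar_succ_le_one hα n
  have h₁ := cfDigit_le_cfTail (α := α) (n + 2)
  have h₂ := cfTail_lt_cfDigit_add_one (α := α) (n + 2)
  have ha' : (2 : ℝ) ≤ cfDigit α (n + 2) := by exact_mod_cast ha
  generalize cfStar α (n + 1) = x at *
  generalize cfTail α (n + 2) = t at *
  generalize cfDigit α (n + 2) = a at *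
  have hs : 0 < t + x := by linarith
  simp only [min_le_iff, div_le_one hs]
  by_contra! hc
  obtain ⟨c₁, c₂, c₄⟩ := hc
  have ha4 : (a : ℝ) < 4 := by linarith
  have ha4' : a < 4 := by exact_mod_cast ha4
  obtain rfl | rfl : a = 2 ∨ a = 3 := by omega
  · push_cast at *
    nlinarith
  · push_cast at *
    nlinarith

lemma le_combination {a u v : ℤ} {t x c : ℝ} (ha : 1 ≤ a) (hat : (a : ℝ) ≤ t) (hta : t < a + 1)
    (hx : 0 < x) (hx₁ : x ≤ 1) (hlow : 1 ≤ u + v * x) (hupp : u + v * x < a + x)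
    (h₁₀ : ¬ (u = 1 ∧ v = 0)) (h₀₁ : ¬ (u = 0 ∧ v = 1)) (hc : c ≤ 1)
    (hκ : 2 ≤ a → c ≤ (1 + x) * (t - 1) / (t + x) ∧ c ≤ (a + x - 1) * (t - a + 1) / (t + x) ∧
      c ≤ 4 / (t + x)) :
    c ≤ (u + v * x) * |u - v * t| / (t + x) := by
  have ha' : (1 : ℝ) ≤ a := by exact_mod_cast ha
  have hs : 0 < t + x := by linarith
  have hcs : c * (t + x) ≤ t + x := by nlinarith
  simp only [le_div_iff₀ hs] at hκ ⊢
  rcases lt_trichotomy v 0 with hv | rfl | hv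
  · have hv' : (v : ℝ) ≤ -1 := by exact_mod_cast (by omega : v ≤ -1)
    have : t + x ≤ u - v * t := by nlinarith
    have := this.trans (le_abs_self _)
    nlinarith
  · simp only [Int.cast_zero, zero_mul, add_zero, sub_zero] at hlow ⊢
    have hu : 1 ≤ u := by exact_mod_cast hlow
    have hu₂ : 2 ≤ u := lt_of_le_of_ne hu fun e => h₁₀ ⟨e.symm, rfl⟩
    have hu' : (2 : ℝ) ≤ u := by exact_mod_cast hu₂
    rw [abs_of_nonneg (by linarith)]
    rcases ha.eq_or_lt with rfl | ha₂
    · push_cast at *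
      nlinarith
    · have := (hκ ha₂).2.2
      nlinarith
  · rcases (show 1 ≤ v by omega).eq_or_lt with rfl | hv₂
    · simp only [Int.cast_one, one_mul] at hlow hupp ⊢
      have hu : 0 ≤ u := by exact_mod_cast (by linarith : (0 : ℝ) ≤ u)
      have hu₁ : 1 ≤ u := lt_of_le_of_ne hu fun e => h₀₁ ⟨e.symm, rfl⟩
      have hua : u < a := by exact_mod_cast (by linarith : (u : ℝ) < a)
      have hu' : (1 : ℝ) ≤ u := by exact_mod_cast hu₁
      have hua' : (u : ℝ) ≤ a - 1 := by exact_mod_cast (by omega : u ≤ a - 1)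
      obtain ⟨k₁, k₂, -⟩ := hκ (by omega)
      rw [abs_sub_comm, abs_of_nonneg (by linarith)]
      rcases le_or_gt (u + 1 + x) t with hle | hgt
      · nlinarith [mul_nonneg (sub_nonneg.2 hu') (sub_nonneg.2 hle)]
      · have : 0 ≤ u + a - 1 + x - t := by linarith
        nlinarith [mul_nonneg (sub_nonneg.2 hua') this]
    · have hv' : (2 : ℝ) ≤ v := by exact_mod_cast hv₂
      have : t + x ≤ v * t - u := by nlinarith
      have := this.trans (le_abs_self _)
      rw [abs_sub_comm]
      nlinarith

end Kappa

section SecondBest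

variable {α : ℝ}

/-- The set of approximation errors whose infimum is `psi2 α t`. -/
def secondBestErrors (α t : ℝ) : Set ℝ :=
  { x : ℝ | ∃ p q : ℤ, 1 ≤ q ∧ (q : ℝ) ≤ t ∧
    (∀ n : ℕ, (p, q) ≠ (cfNum α n, cfDen α n)) ∧ x = |(q : ℝ) * α - (p : ℝ)| }

lemma bddBelow_secondBestErrors (α t : ℝ) : BddBelow (secondBestErrors α t) :=
  ⟨0, by rintro _ ⟨p, q, -, -, -, rfl⟩; exact abs_nonneg _⟩

lemma mul_psi2_le {p q : ℤ} (hq : 1 ≤ q) (hne : ∀ n : ℕ, (p, q) ≠ (cfNum α n, cfDen α n)) :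
    (q : ℝ) * psi2 α q ≤ q * |(q : ℝ) * α - p| := by
  have hq' : (0 : ℝ) ≤ q := by exact_mod_cast (by omega : 0 ≤ q)
  exact mul_le_mul_of_nonneg_left
    (csInf_le (bddBelow_secondBestErrors α q) ⟨p, q, hq, le_rfl, hne, rfl⟩) hq'

lemma exists_mul_psi2_le_combination (hα : Irrational α) (n : ℕ) (u v : ℤ)
    (h₁ : cfDen α (n + 1) < u * cfDen α (n + 1) + v * cfDen α n)
    (h₂ : u * cfDen α (n + 1) + v * cfDen α n < cfDen α (n + 2)) :
    ∃ q : ℤ, (n : ℤ) ≤ q ∧ (q : ℝ) * psi2 α q ≤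
      (u + v * cfStar α (n + 1)) * |u - v * cfTail α (n + 2)|
        / (cfTail α (n + 2) + cfStar α (n + 1)) := by
  refine ⟨u * cfDen α (n + 1) + v * cfDen α n, ?_, ?_⟩
  · have := le_cfDen hα (n + 1)
    push_cast at this
    omega
  · rw [← mul_abs_combination hα]
    refine mul_psi2_le ?_ (ne_convergent_of_between hα h₁ h₂)
    have := cfDen_pos hα (n + 1)
    omega

lemma le_min_kappa (hα : Irrational α) {n : ℕ} (ha : 2 ≤ cfDigit α (n + 2)) {c : ℝ}
    (hc : ∀ q : ℤ, (n : ℤ) ≤ q → c ≤ q * psi2 α q) :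
    c ≤ min (kappa1 α (n + 2)) (min (kappa2 α (n + 2)) (kappa4 α (n + 2))) := by
  have hd₀ := cfDen_pos hα n
  have hd₁ := cfDen_pos hα (n + 1)
  have hd₂ : cfDen α (n + 2) = cfDigit α (n + 2) * cfDen α (n + 1) + cfDen α n := rfl
  have ht := one_lt_cfTail_succ hα (n + 1)
  have hat := cfDigit_le_cfTail (α := α) (n + 2)
  rw [kappa2_eq hα, kappa1, kappa4, show n + 2 - 1 = n + 1 from rfl]
  refine le_min ?_ (le_min ?_ ?_)
  · obtain ⟨q, hq, hle⟩ := exists_mul_psi2_le_combination hα n 1 1 (by omega) (by nlinarith)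
    refine (hc q hq).trans (hle.trans_eq ?_)
    push_cast
    rw [one_mul, one_mul, abs_sub_comm, abs_of_nonneg (by linarith)]
  · obtain ⟨q, hq, hle⟩ := exists_mul_psi2_le_combination hα n (cfDigit α (n + 2) - 1) 1
      (by nlinarith) (by nlinarith)
    refine (hc q hq).trans (hle.trans_eq ?_)
    push_cast
    rw [one_mul, one_mul, abs_sub_comm, abs_of_nonneg (by linarith)]
    ring
  · obtain ⟨q, hq, hle⟩ := exists_mul_psi2_le_combination hα n 2 0 (by omega) (by nlinarith)
    refine (hc q hq).trans (hle.trans_eq ?_)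
    norm_num

lemma exists_pos_le_abs_sub (hα : Irrational α) (Q : ℕ) :
    ∃ δ > 0, ∀ p q : ℤ, 1 ≤ q → q ≤ Q → δ ≤ |(q : ℝ) * α - p| := by
  induction Q with
  | zero => exact ⟨1, one_pos, fun p q h₁ h₂ => by push_cast at h₂; omega⟩
  | succ Q ih =>
    obtain ⟨δ, hδ, h⟩ := ih
    have hirr : Irrational (((Q + 1 : ℕ) : ℝ) * α) := hα.natCast_mul Q.succ_ne_zero
    refine ⟨min δ |((Q + 1 : ℕ) : ℝ) * α - round (((Q + 1 : ℕ) : ℝ) * α)|,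
      lt_min hδ (abs_pos.2 (sub_ne_zero.2 (hirr.ne_int _))), fun p q h₁ h₂ => ?_⟩
    rcases h₂.eq_or_lt with rfl | hlt
    · exact (min_le_right _ _).trans (by simpa using round_le (((Q + 1 : ℕ) : ℝ) * α) p)
    · exact (min_le_left _ _).trans (h p q h₁ (by push_cast at hlt; omega))

lemma le_mul_abs_of_cfDen_le (hα : Irrational α) {N : ℕ} {c : ℝ} (hc : c ≤ 1)
    (hN : ∀ n ≥ N, 2 ≤ cfDigit α (n + 2) →
      c ≤ min (kappa1 α (n + 2)) (min (kappa2 α (n + 2)) (kappa4 α (n + 2))))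
    {p q : ℤ} (hq : cfDen α (N + 1) ≤ q) (hne : ∀ n : ℕ, (p, q) ≠ (cfNum α n, cfDen α n)) :
    c ≤ q * |(q : ℝ) * α - p| := by
  obtain ⟨n, hnN, hn₁, hn₂⟩ : ∃ n ≥ N, cfDen α (n + 1) ≤ q ∧ q < cfDen α (n + 2) := by
    have hex : ∃ m, q < cfDen α m := ⟨(q + 1).toNat, by
      have := le_cfDen hα (q + 1).toNat
      omega⟩
    have hspec := Nat.find_spec hex
    have hgt : N + 1 < Nat.find hex := by
      by_contra! hle
      have := cfDen_mono hα hle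
      omega
    refine ⟨Nat.find hex - 2, by omega, ?_, ?_⟩
    · exact not_lt.1 (Nat.find_min hex (m := Nat.find hex - 2 + 1) (by omega))
    · rwa [show Nat.find hex - 2 + 2 = Nat.find hex by omega]
  obtain ⟨u, v, rfl, rfl⟩ := exists_eq_combination α n p q
  rw [mul_abs_combination hα]
  have h₁ : (0 : ℝ) < cfDen α (n + 1) := by exact_mod_cast cfDen_pos hα (n + 1)
  have e : cfStar α (n + 1) * cfDen α (n + 1) = cfDen α n := by
    rw [cfStar_succ_eq_div hα]
    field_simp
  have hn₁' : (cfDen α (n + 1) : ℝ) ≤ u * cfDen α (n + 1) + v * cfDen α n := by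
    exact_mod_cast hn₁
  have hn₂' : (u * cfDen α (n + 1) + v * cfDen α n : ℝ)
      < cfDigit α (n + 2) * cfDen α (n + 1) + cfDen α n := by
    exact_mod_cast hn₂
  rw [← e] at hn₁' hn₂'
  refine le_combination (one_le_cfDigit_succ hα (n + 1)) (cfDigit_le_cfTail _)
    (cfTail_lt_cfDigit_add_one _) (cfStar_succ_pos hα n) (cfStar_succ_le_one hα n)
    ?_ ?_ ?_ ?_ hc fun ha => ?_
  · nlinarith
  · nlinarith
  · rintro ⟨rfl, rfl⟩
    exact hne (n + 1) (by simp)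
  · rintro ⟨rfl, rfl⟩
    exact hne n (by simp)
  · have := hN n hnN ha
    rw [kappa2_eq hα, kappa1, kappa4, show n + 2 - 1 = n + 1 from rfl] at this
    simpa only [le_min_iff] using this

lemma eventually_le_mul_psi2 (hα : Irrational α) (hfreq : ∃ᶠ n in atTop, 2 ≤ cfDigit α n)
    {N : ℕ} {c : ℝ} (hc : c ≤ 1)
    (hN : ∀ n ≥ N, 2 ≤ cfDigit α (n + 2) →
      c ≤ min (kappa1 α (n + 2)) (min (kappa2 α (n + 2)) (kappa4 α (n + 2)))) :
    ∀ᶠ t : ℝ in atTop, c ≤ t * psi2 α t := by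
  obtain ⟨δ, hδ, hδ'⟩ := exists_pos_le_abs_sub hα (cfDen α (N + 1)).toNat
  obtain ⟨m, hm, hm₂⟩ := frequently_atTop.1 hfreq 2
  obtain ⟨n, rfl⟩ := Nat.exists_eq_add_of_le' hm
  have hd₀ := cfDen_pos hα n
  have hd₁ := cfDen_pos hα (n + 1)
  have hd₂ : cfDen α (n + 2) = cfDigit α (n + 2) * cfDen α (n + 1) + cfDen α n := rfl
  filter_upwards [eventually_ge_atTop (c / δ), eventually_gt_atTop (0 : ℝ),
    eventually_ge_atTop ((2 * cfDen α (n + 1) : ℤ) : ℝ)] with t ht₁ ht₀ ht₂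
  rw [← div_le_iff₀' ht₀]
  refine le_csInf ⟨_, 0, 2 * cfDen α (n + 1), by omega, ht₂, ?_, rfl⟩ ?_
  · exact ne_convergent_of_between hα (n := n + 1) (by omega) (by nlinarith)
  · rintro _ ⟨p, q, hq, hqt, hne, rfl⟩
    rw [div_le_iff₀' ht₀]
    rcases le_or_gt (cfDen α (N + 1)) q with hle | hlt
    · exact (le_mul_abs_of_cfDen_le hα hc hN hle hne).trans
        (mul_le_mul_of_nonneg_right hqt (abs_nonneg _))
    · rw [div_le_iff₀ hδ] at ht₁
      exact ht₁.trans (mul_le_mul_of_nonneg_left (hδ' p q hq (by omega)) ht₀.le)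

end SecondBest

/-- If `α` is irrational and not equivalent to the golden ratio, then
`𝔨(α) = liminf_{n → ∞, aₙ ≥ 2} min(κ¹ₙ, κ²ₙ, κ⁴ₙ)`. -/
theorem stmt_9 (α : ℝ) (hα : Irrational α)
    (h : ¬ CFEquiv α ((1 + Real.sqrt 5) / 2)) :
    kConst α =
      liminf (fun n : ℕ => min (kappa1 α n) (min (kappa2 α n) (kappa4 α n)))
        (atTop ⊓ 𝓟 {n : ℕ | 2 ≤ cfDigit α n}) := by
  have hfreq := frequently_two_le_cfDigit hα h
  rw [kConst, liminf_eq, liminf_eq]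
  congr 1
  ext c
  simp only [Set.mem_ofPred_eq, eventually_inf_principal]
  constructor
  · intro hc
    obtain ⟨T, hT⟩ := eventually_atTop.1 hc
    filter_upwards [eventually_ge_atTop (⌈T⌉₊ + 2)] with m hm ha
    obtain ⟨n, rfl⟩ := Nat.exists_eq_add_of_le' (show 2 ≤ m by omega)
    refine le_min_kappa hα ha fun q hq => hT q ((Nat.le_ceil T).trans ?_)
    exact_mod_cast (show ((⌈T⌉₊ : ℕ) : ℤ) ≤ q by omega)
  · intro hc
    have hc₁ : c ≤ 1 := by
      obtain ⟨m, ⟨hm, hcm⟩, ha⟩ :=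
        ((eventually_ge_atTop 2).and hc |>.and_frequently hfreq).exists
      obtain ⟨n, rfl⟩ := Nat.exists_eq_add_of_le' hm
      exact (hcm ha).trans (min_kappa_le_one hα n ha)
    obtain ⟨N, hN⟩ := eventually_atTop.1 hc
    exact eventually_le_mul_psi2 hα hfreq hc₁ fun n hn => hN (n + 2) (Nat.le_add_right_of_le hn)
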